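/- arXiv:2509.22233 — 2 statements merged into one kernel-verified Lean document; each statement's English description precedes it below -/
import Mathlib

section
/- Let G be a simple graph with a proper 3-coloring c, and let W be a walk of length ℓ from u to v in G. Then p(W) ≡ i(u) + i(v) + ℓ (mod 2), where i(w) = 1 if c(w) = 3 and i(w) = 0 otherwise. -/
/-- The potential of an edge, given a coloring `c`. -/
def pot {V : Type*} (c : V → ℤ) (u v : V) : ℤ :=
  if c u ≠ 3 ∧ c v ≠ 3 then c u - c v else 0

/-- The indicator `i(w)` which is `1` if `c w = 3` and `0` otherwise. -/
def ind {V : Type*} (c : V → ℤ) (w : V) : ℤ :=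
  if c w = 3 then 1 else 0

/-- The parity statement for a single edge. -/
theorem pot_modEq_of_ne {V : Type*} (c : V → ℤ)
    (hc_range : ∀ v, c v = 1 ∨ c v = 2 ∨ c v = 3) {u v : V} (huv : c u ≠ c v) :
    pot c u v ≡ ind c u + ind c v + 1 [ZMOD 2] := by
  rcases hc_range u with hu | hu | hu <;> rcases hc_range v with hv | hv | hv <;>
    simp_all [pot, ind, Int.ModEq]

/-- Let `G` be a simple graph with a proper 3-coloring `c`, and let `W` be a walk of
length `ℓ` from `u = w 0` to `v = w ℓ` in `G`. Then
`p(W) ≡ i(u) + i(v) + ℓ (mod 2)`. -/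
theorem potential_parity
    {V : Type*} (G : SimpleGraph V)
    (c : V → ℤ)
    (hc_range : ∀ v, c v = 1 ∨ c v = 2 ∨ c v = 3)
    (hc_proper : ∀ u v, G.Adj u v → c u ≠ c v)
    (ℓ : ℕ) (w : ℕ → V)
    (hwalk : ∀ i, i < ℓ → G.Adj (w i) (w (i + 1))) :
    (∑ i ∈ Finset.range ℓ, pot c (w i) (w (i + 1)))
      ≡ ind c (w 0) + ind c (w ℓ) + (ℓ : ℤ) [ZMOD 2] := by
  induction ℓ with
  | zero => simp [Int.ModEq]; omega
  | succ n ih =>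
    have hsum := ih fun i hi => hwalk i (by omega)
    have hedge := pot_modEq_of_ne c hc_range (hc_proper _ _ (hwalk n (by omega)))
    rw [Finset.sum_range_succ]
    simp only [Int.ModEq] at *
    push_cast
    omega
end

section
/- Let G be a simple graph with a proper 3-coloring c. Then for every walk W in G, |p(W)| ≤ ⌈|W|/3⌉; in particular p(W) ≤ |W|/3 + 1. -/
/-- A function on colors whose coboundary, up to an error of one per edge, is three times
the potential. -/
def potHeight (k : ℤ) : ℤ :=
  if k = 1 then 2 else if k = 2 then 0 else 1

theorem potHeight_nonneg (k : ℤ) : 0 ≤ potHeight k := by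
  unfold potHeight
  split_ifs <;> norm_num

theorem potHeight_le_two (k : ℤ) : potHeight k ≤ 2 := by
  unfold potHeight
  split_ifs <;> norm_num

theorem abs_three_mul_pot_sub_potHeight_le_one {V : Type*} (c : V → ℤ)
    (hc_range : ∀ v, c v = 1 ∨ c v = 2 ∨ c v = 3) {u v : V} (huv : c u ≠ c v) :
    |3 * pot c u v - (potHeight (c v) - potHeight (c u))| ≤ 1 := by
  unfold pot potHeight
  rcases hc_range u with hu | hu | hu <;> rcases hc_range v with hv | hv | hv <;>
    simp_all

theorem abs_three_mul_sum_pot_sub_potHeight_le {V : Type*} (c : V → ℤ)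
    (hc_range : ∀ v, c v = 1 ∨ c v = 2 ∨ c v = 3) (w : ℕ → V) (m : ℕ)
    (hw : ∀ i, i < m → c (w i) ≠ c (w (i + 1))) :
    |3 * ∑ i ∈ Finset.range m, pot c (w i) (w (i + 1)) -
      (potHeight (c (w m)) - potHeight (c (w 0)))| ≤ m := by
  induction m with
  | zero => simp
  | succ m ih =>
    have hm := ih fun i hi => hw i (by omega)
    have hstep := abs_three_mul_pot_sub_potHeight_le_one c hc_range (hw m (by omega))
    rw [Finset.sum_range_succ]
    rw [abs_le] at *
    push_cast
    constructor <;> linarith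

/-- Let `G` be a simple graph with a proper 3-coloring `c`. Then for every walk `W`
of length `m` in `G`, `|p(W)| ≤ ⌈m/3⌉`; in particular `p(W) ≤ m/3 + 1`. -/
theorem potential_upper_bound
    {V : Type*} (G : SimpleGraph V)
    (c : V → ℤ)
    (hc_range : ∀ v, c v = 1 ∨ c v = 2 ∨ c v = 3)
    (hc_proper : ∀ u v, G.Adj u v → c u ≠ c v)
    (m : ℕ) (w : ℕ → V)
    (hwalk : ∀ i, i < m → G.Adj (w i) (w (i + 1))) :
    |∑ i ∈ Finset.range m, pot c (w i) (w (i + 1))| ≤ ⌈(m : ℚ) / 3⌉ ∧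
    ((∑ i ∈ Finset.range m, pot c (w i) (w (i + 1)) : ℤ) : ℚ) ≤ (m : ℚ) / 3 + 1 := by
  have h := abs_three_mul_sum_pot_sub_potHeight_le c hc_range w m
    fun i hi => hc_proper _ _ (hwalk i hi)
  generalize ∑ i ∈ Finset.range m, pot c (w i) (w (i + 1)) = S at h ⊢
  have habs : 3 * |S| ≤ m + 2 := by
    have h₁ := potHeight_nonneg (c (w m))
    have h₂ := potHeight_le_two (c (w m))
    have h₃ := potHeight_nonneg (c (w 0))
    have h₄ := potHeight_le_two (c (w 0))
    rw [abs_le] at h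
    rcases abs_cases S with ⟨hS, -⟩ | ⟨hS, -⟩ <;> linarith
  have hcast : 3 * ((|S| : ℤ) : ℚ) ≤ m + 2 := by exact_mod_cast habs
  have hle : (S : ℚ) ≤ ((|S| : ℤ) : ℚ) := by exact_mod_cast le_abs_self S
  constructor
  · rw [Int.le_ceil_iff]
    linarith
  · linarith
end
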